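/- Let w_1,…,w_J > 0 and define f_w : H → ℝ∪{+∞} by f_w((x_1,…,x_J)) := Σ_{j=1}^J w_j·‖x_j‖_{A_j}. Set κ_w := (max_{1≤j≤J} w_j·sqrt(K_j)) / (min_{1≤j≤J} w_j·sqrt(K_j)). Then δ_Σ(f_w) ≥ 1/sqrt(2 + J·κ_w²). In particular, for the weights w_j = 1/sqrt(K_j) (so κ_w = 1), δ_Σ(f_w) ≥ 1/sqrt(2 + J). -/

import Mathlib

open scoped RealInnerProductSpace Pointwise ENNReal
open Metric

variable {H : Type*} [NormedAddCommGroup H] [InnerProductSpace ℝ H]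

noncomputable def atomicNorm (A : Set H) (x : H) : ℝ≥0∞ :=
  ⨅ t : {t : ℝ // 0 ≤ t ∧ x ∈ t • closure (convexHull ℝ A)}, ENNReal.ofReal (t : ℝ)

noncomputable def coneNorm (S : Set H) (x : H) : ℝ≥0∞ :=
  atomicNorm (S ∩ sphere (0 : H) 1) x

noncomputable def gproj (e : ℕ → H) (g : Finset ℕ) (x : H) : H :=
  ∑ i ∈ g, ⟪x, e i⟫ • e i

noncomputable def gprojS (e : ℕ → H) (Hs : Finset (Finset ℕ)) (x : H) : H :=
  ∑ g ∈ Hs, gproj e g x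

def Egrp (e : ℕ → H) (G : Finset (Finset ℕ)) : Set H :=
  (Submodule.span ℝ (e '' (G.biUnion id : Finset ℕ)) : Set H)

def SigmaK (e : ℕ → H) (G : Finset (Finset ℕ)) (K : ℕ) : Set H :=
  {x : H | ∃ H' ⊆ G, H'.card ≤ K ∧ x = gprojS e H' x}

noncomputable def groupNormR (e : ℕ → H) (G : Finset (Finset ℕ)) (x : H) : ℝ :=
  ∑ g ∈ G, ‖gproj e g x‖

open Classical in
noncomputable def groupNorm (e : ℕ → H) (G : Finset (Finset ℕ)) (x : H) : ℝ≥0∞ :=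
  if x ∈ Egrp e G then ENNReal.ofReal (groupNormR e G x) else ⊤

noncomputable def dualNorm (e : ℕ → H) (G : Finset (Finset ℕ)) (x : H) : ℝ :=
  sSup ((fun g => ‖gproj e g x‖) '' (G : Set (Finset ℕ)))

noncomputable def deltaUoS (S : Set H) (x z : H) : ℝ :=
  if coneNorm S (x + z) = ⊤ then 0
  else (-⟪x, z⟫) /
    (‖x‖ * Real.sqrt ((coneNorm S (x + z)).toReal ^ 2 - ‖x‖ ^ 2 - 2 * ⟪x, z⟫))

noncomputable def deltaAdmUoS (S T : Set H) : EReal :=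
  ⨅ z : {z : H // z ∈ T ∧ z ≠ 0}, ⨆ x : {x : H // x ∈ S ∧ x ≠ 0},
    ((deltaUoS S (x : H) (z : H) : ℝ) : EReal)

variable {J : ℕ} {Hs : Fin J → Type*} [∀ j, NormedAddCommGroup (Hs j)]
  [∀ j, InnerProductSpace ℝ (Hs j)]

/-- The block structured sparsity model `Σ = Σ_1 × … × Σ_J` in the product Hilbert space. -/
def blockModel (e : ∀ j, ℕ → Hs j) (G : Fin J → Finset (Finset ℕ)) (K : Fin J → ℕ) :
    Set (PiLp 2 Hs) :=
  {x : PiLp 2 Hs | ∀ j, x j ∈ SigmaK (e j) (G j) (K j)}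

/-- The weighted block structured norm `f_w(x) = ∑ j, w j * ‖x j‖_{A_j}`. -/
noncomputable def blockNorm (e : ∀ j, ℕ → Hs j) (G : Fin J → Finset (Finset ℕ))
    (w : Fin J → ℝ) (x : PiLp 2 Hs) : ℝ≥0∞ :=
  ∑ j, ENNReal.ofReal (w j) * groupNorm (e j) (G j) (x j)

theorem inner_gproj_basis {e : ℕ → H} (he : Orthonormal ℝ e) (g : Finset ℕ) (x : H) (i : ℕ) :
    ⟪gproj e g x, e i⟫ = if i ∈ g then ⟪x, e i⟫ else 0 := by
  classical
  simp [gproj, sum_inner, inner_smul_left, orthonormal_iff_ite.mp he]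

theorem inner_gproj_left (e : ℕ → H) (g : Finset ℕ) (x y : H) :
    ⟪gproj e g x, y⟫ = ⟪x, gproj e g y⟫ := by
  simp only [gproj, sum_inner, inner_sum, inner_smul_left, inner_smul_right]
  exact Finset.sum_congr rfl fun i _ => by
    simp [real_inner_comm, mul_comm]

theorem gproj_add (e : ℕ → H) (g : Finset ℕ) (x y : H) :
    gproj e g (x + y) = gproj e g x + gproj e g y := by
  simp [gproj, inner_add_left, add_smul, Finset.sum_add_distrib]

theorem gproj_smul (e : ℕ → H) (g : Finset ℕ) (c : ℝ) (x : H) :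
    gproj e g (c • x) = c • gproj e g x := by
  simp [gproj, inner_smul_left, mul_smul, Finset.smul_sum]

theorem gproj_sum {ι : Type*} (e : ℕ → H) (g : Finset ℕ) (s : Finset ι) (f : ι → H) :
    gproj e g (∑ i ∈ s, f i) = ∑ i ∈ s, gproj e g (f i) := by
  simp only [gproj, sum_inner, Finset.sum_smul]
  exact Finset.sum_comm

theorem gprojS_smul (e : ℕ → H) (S : Finset (Finset ℕ)) (c : ℝ) (x : H) :
    gprojS e S (c • x) = c • gprojS e S x := by
  simp [gprojS, gproj_smul, Finset.smul_sum]

theorem gproj_gproj_self {e : ℕ → H} (he : Orthonormal ℝ e) (g : Finset ℕ) (x : H) :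
    gproj e g (gproj e g x) = gproj e g x := by
  conv_lhs => rw [gproj]
  conv_rhs => rw [gproj]
  exact Finset.sum_congr rfl fun i hi => by rw [inner_gproj_basis he, if_pos hi]

theorem gproj_gproj_of_disjoint {e : ℕ → H} (he : Orthonormal ℝ e) {g g' : Finset ℕ}
    (h : Disjoint g g') (x : H) : gproj e g (gproj e g' x) = 0 := by
  conv_lhs => rw [gproj]
  refine Finset.sum_eq_zero fun i hi => ?_
  rw [inner_gproj_basis he, if_neg (Finset.disjoint_left.mp h hi), zero_smul]

theorem gproj_gprojS_of_mem {e : ℕ → H} (he : Orthonormal ℝ e) {G S : Finset (Finset ℕ)}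
    (hG : (G : Set (Finset ℕ)).Pairwise fun g g' => Disjoint g g') (hS : S ⊆ G)
    {g : Finset ℕ} (hg : g ∈ S) (x : H) : gproj e g (gprojS e S x) = gproj e g x := by
  rw [gprojS, gproj_sum, Finset.sum_eq_single_of_mem g hg, gproj_gproj_self he]
  exact fun h hh hne => gproj_gproj_of_disjoint he (hG (hS hg) (hS hh) hne.symm) x

theorem gproj_gprojS_of_notMem {e : ℕ → H} (he : Orthonormal ℝ e) {G S : Finset (Finset ℕ)}
    (hG : (G : Set (Finset ℕ)).Pairwise fun g g' => Disjoint g g') (hS : S ⊆ G)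
    {g : Finset ℕ} (hgG : g ∈ G) (hg : g ∉ S) (x : H) : gproj e g (gprojS e S x) = 0 := by
  rw [gprojS, gproj_sum]
  refine Finset.sum_eq_zero fun h hh => gproj_gproj_of_disjoint he (hG hgG (hS hh) ?_) x
  rintro rfl
  exact hg hh

theorem gprojS_gprojS_self {e : ℕ → H} (he : Orthonormal ℝ e) {G S : Finset (Finset ℕ)}
    (hG : (G : Set (Finset ℕ)).Pairwise fun g g' => Disjoint g g') (hS : S ⊆ G) (x : H) :
    gprojS e S (gprojS e S x) = gprojS e S x := by
  conv_lhs => rw [gprojS]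
  exact Finset.sum_congr rfl fun g hg => gproj_gprojS_of_mem he hG hS hg x

theorem inner_gprojS_left (e : ℕ → H) (S : Finset (Finset ℕ)) (x y : H) :
    ⟪gprojS e S x, y⟫ = ⟪x, gprojS e S y⟫ := by
  simp only [gprojS, sum_inner, inner_sum, inner_gproj_left]

theorem inner_gprojS_self {e : ℕ → H} (he : Orthonormal ℝ e) {G S : Finset (Finset ℕ)}
    (hG : (G : Set (Finset ℕ)).Pairwise fun g g' => Disjoint g g') (hS : S ⊆ G) (x : H) :
    ⟪gprojS e S x, x⟫ = ‖gprojS e S x‖ ^ 2 := by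
  rw [← real_inner_self_eq_norm_sq, inner_gprojS_left, inner_gprojS_left,
    gprojS_gprojS_self he hG hS]

theorem norm_gprojS_sq {e : ℕ → H} (he : Orthonormal ℝ e) {G S : Finset (Finset ℕ)}
    (hG : (G : Set (Finset ℕ)).Pairwise fun g g' => Disjoint g g') (hS : S ⊆ G) (x : H) :
    ‖gprojS e S x‖ ^ 2 = ∑ g ∈ S, ‖gproj e g x‖ ^ 2 := by
  rw [← inner_gprojS_self he hG hS, gprojS, sum_inner]
  refine Finset.sum_congr rfl fun g _ => ?_
  rw [← real_inner_self_eq_norm_sq, inner_gproj_left, inner_gproj_left, gproj_gproj_self he]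

theorem gprojS_mem_Egrp (e : ℕ → H) {G S : Finset (Finset ℕ)} (hS : S ⊆ G) (x : H) :
    gprojS e S x ∈ Egrp e G := by
  refine Submodule.sum_mem _ fun g hg => Submodule.sum_mem _ fun i hi => ?_
  refine Submodule.smul_mem _ _ (Submodule.subset_span ⟨i, ?_, rfl⟩)
  simpa using ⟨g, hS hg, hi⟩

theorem gprojS_eq_self_of_mem_Egrp {e : ℕ → H} (he : Orthonormal ℝ e) {G : Finset (Finset ℕ)}
    (hG : (G : Set (Finset ℕ)).Pairwise fun g g' => Disjoint g g') {x : H}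
    (hx : x ∈ Egrp e G) : gprojS e G x = x := by
  classical
  have h : ∀ y, gprojS e G y = gproj e (G.biUnion id) y := fun y => by
    exact (Finset.sum_biUnion (t := id) hG).symm
  rw [h]
  refine Submodule.span_induction (p := fun y _ => gproj e (G.biUnion id) y = y)
    ?_ ?_ ?_ ?_ hx
  · rintro _ ⟨i, hi, rfl⟩
    simp only [gproj, orthonormal_iff_ite.mp he, ite_smul, one_smul, zero_smul,
      Finset.sum_ite_eq]
    exact if_pos hi
  · simp [gproj]
  · intro a b _ _ ha hb
    rw [gproj_add, ha, hb]
  · intro c a _ ha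
    rw [gproj_smul, ha]

theorem gprojS_mem_SigmaK {e : ℕ → H} (he : Orthonormal ℝ e) {G S : Finset (Finset ℕ)}
    (hG : (G : Set (Finset ℕ)).Pairwise fun g g' => Disjoint g g') (hS : S ⊆ G) {K : ℕ}
    (hK : S.card ≤ K) (x : H) : gprojS e S x ∈ SigmaK e G K :=
  ⟨S, hS, hK, (gprojS_gprojS_self he hG hS x).symm⟩

theorem SigmaK_smul_mem {e : ℕ → H} {G : Finset (Finset ℕ)} {K : ℕ} {x : H}
    (hx : x ∈ SigmaK e G K) (c : ℝ) : c • x ∈ SigmaK e G K := by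
  obtain ⟨S, hS, hK, h⟩ := hx
  exact ⟨S, hS, hK, by rw [gprojS_smul, ← h]⟩

theorem exists_subset_card_eq_threshold {ι : Type*} [DecidableEq ι] (G : Finset ι) (b : ι → ℝ)
    {K : ℕ} (hK1 : 1 ≤ K) (hKG : K ≤ G.card) :
    ∃ S ⊆ G, S.card = K ∧ ∃ β, (∃ g ∈ S, b g = β) ∧ (∀ g ∈ S, β ≤ b g) ∧
      ∀ g ∈ G \ S, b g ≤ β := by
  induction K, hK1 using Nat.le_induction with
  | base =>
    obtain ⟨m, hm, hmax⟩ := G.exists_max_image b (Finset.card_pos.mp hKG)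
    exact ⟨{m}, by simpa using hm, by simp, b m, by simp, by simp,
      fun g hg => hmax g (Finset.mem_sdiff.mp hg).1⟩
  | succ n hn ih =>
    obtain ⟨S, hSG, hcard, β, -, hS, hSc⟩ := ih (by omega)
    have hne : (G \ S).Nonempty := by
      rw [← Finset.card_pos, Finset.card_sdiff_of_subset hSG]
      omega
    obtain ⟨m, hm, hmax⟩ := (G \ S).exists_max_image b hne
    have hm' := Finset.mem_sdiff.mp hm
    refine ⟨insert m S, Finset.insert_subset hm'.1 hSG, ?_, b m,
      ⟨m, Finset.mem_insert_self _ _, rfl⟩, ?_, ?_⟩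
    · rw [Finset.card_insert_of_notMem hm'.2, hcard]
    · intro g hg
      rcases Finset.mem_insert.mp hg with rfl | hg
      · exact le_rfl
      · exact (hSc m hm).trans (hS g hg)
    · intro g hg
      simp only [Finset.mem_sdiff, Finset.mem_insert, not_or] at hg
      exact hmax g (Finset.mem_sdiff.mpr ⟨hg.1, hg.2.2⟩)

theorem sum_mul_le_mul_sum_of_threshold {ι : Type*} [DecidableEq ι] {G S : Finset ι}
    (hS : S ⊆ G) {b c : ι → ℝ} {α β : ℝ} (hβ0 : 0 ≤ β) (hβS : ∀ g ∈ S, β ≤ b g)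
    (hβ : ∀ g ∈ G \ S, b g ≤ β) (hc0 : ∀ g ∈ G, 0 ≤ c g) (hcα : ∀ g ∈ G, c g ≤ α)
    (hsum : ∑ g ∈ G, c g ≤ S.card * α) :
    ∑ g ∈ G, b g * c g ≤ α * ∑ g ∈ S, b g := by
  rw [← Finset.sum_sdiff hS] at hsum ⊢
  have h1 : ∑ g ∈ G \ S, b g * c g ≤ β * ∑ g ∈ G \ S, c g := by
    rw [Finset.mul_sum]
    exact Finset.sum_le_sum fun g hg =>
      mul_le_mul_of_nonneg_right (hβ g hg) (hc0 g (Finset.mem_sdiff.mp hg).1)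
  have h2 : ∑ g ∈ S, (b g * c g + β * (α - c g)) ≤ ∑ g ∈ S, α * b g :=
    Finset.sum_le_sum fun g hg => by
      nlinarith [mul_nonneg (sub_nonneg.mpr (hβS g hg)) (sub_nonneg.mpr (hcα g (hS hg)))]
  rw [Finset.sum_add_distrib, ← Finset.mul_sum, ← Finset.mul_sum, Finset.sum_sub_distrib,
    Finset.sum_const, nsmul_eq_mul] at h2
  nlinarith [mul_le_mul_of_nonneg_left hsum hβ0]

theorem sum_norm_gproj_le {e : ℕ → H} (he : Orthonormal ℝ e) {G S : Finset (Finset ℕ)}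
    (hG : (G : Set (Finset ℕ)).Pairwise fun g g' => Disjoint g g') (hS : S ⊆ G) (x : H) :
    ∑ g ∈ S, ‖gproj e g x‖ ≤ √S.card * ‖gprojS e S x‖ := by
  refine le_of_sq_le_sq ?_ (by positivity)
  rw [mul_pow, Real.sq_sqrt (by positivity), norm_gprojS_sq he hG hS]
  exact sq_sum_le_card_mul_sum_sq

/-- The support function of the `K`-group-sparse unit ball controls the polytope
`‖·‖_{A}^* ≤ α`, `‖·‖_A ≤ K α`. -/
theorem exists_inner_le_mul_norm_gprojS {e : ℕ → H} (he : Orthonormal ℝ e)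
    {G : Finset (Finset ℕ)} (hG : (G : Set (Finset ℕ)).Pairwise fun g g' => Disjoint g g')
    {K : ℕ} (hK1 : 1 ≤ K) (hKG : K ≤ G.card) {u : H} (hu : gprojS e G u = u) {α : ℝ}
    (hα : ∀ g ∈ G, ‖gproj e g u‖ ≤ α) (hsum : groupNormR e G u ≤ K * α) (y : H) :
    ∃ S ⊆ G, S.card ≤ K ∧ ⟪y, u⟫ ≤ α * √K * ‖gprojS e S y‖ := by
  obtain ⟨S, hS, hcard, β, ⟨g₀, hg₀, hβ⟩, hβS, hβc⟩ :=
    exists_subset_card_eq_threshold G (fun g => ‖gproj e g y‖) hK1 hKG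
  refine ⟨S, hS, hcard.le, ?_⟩
  have hα0 : 0 ≤ α := (norm_nonneg _).trans (hα g₀ (hS hg₀))
  calc ⟪y, u⟫ = ∑ g ∈ G, ⟪gproj e g y, gproj e g u⟫ := by
        conv_lhs => rw [← hu, gprojS, inner_sum]
        refine Finset.sum_congr rfl fun g _ => ?_
        rw [inner_gproj_left, gproj_gproj_self he]
    _ ≤ ∑ g ∈ G, ‖gproj e g y‖ * ‖gproj e g u‖ :=
        Finset.sum_le_sum fun g _ => real_inner_le_norm _ _
    _ ≤ α * ∑ g ∈ S, ‖gproj e g y‖ :=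
        sum_mul_le_mul_sum_of_threshold hS (hβ ▸ norm_nonneg _) hβS hβc
          (fun _ _ => norm_nonneg _) hα (by rw [hcard]; exact hsum)
    _ ≤ α * (√S.card * ‖gprojS e S y‖) :=
        mul_le_mul_of_nonneg_left (sum_norm_gproj_le he hG hS y) hα0
    _ = α * √K * ‖gprojS e S y‖ := by rw [hcard, mul_assoc]

theorem le_groupNormR_add_sub {e : ℕ → H} (he : Orthonormal ℝ e) {G T : Finset (Finset ℕ)}
    (hG : (G : Set (Finset ℕ)).Pairwise fun g g' => Disjoint g g') (hT : T ⊆ G)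
    {x : H} (hx : x ∈ SigmaK e G T.card) (z : H) {β : ℝ} (hβ0 : 0 ≤ β)
    (hβT : ∀ g ∈ T, β ≤ ‖gproj e g z‖) (hβ : ∀ g ∈ G \ T, ‖gproj e g z‖ ≤ β) :
    ∑ g ∈ G \ T, ‖gproj e g z‖ - ∑ g ∈ T, ‖gproj e g z‖ ≤
      groupNormR e G (x + z) - groupNormR e G x := by
  obtain ⟨S, hS, hcard, hxS⟩ := hx
  have h1 : ∑ g ∈ S, ‖gproj e g z‖ ≤ ∑ g ∈ T, ‖gproj e g z‖ := by
    have := sum_mul_le_mul_sum_of_threshold (c := fun g => if g ∈ S then (1 : ℝ) else 0) (α := 1)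
      hT hβ0 hβT hβ (fun g _ => by split_ifs <;> simp) (fun g _ => by split_ifs <;> simp) (by
        rw [Finset.sum_ite_mem, Finset.inter_eq_right.mpr hS]
        simpa using hcard)
    simpa [Finset.sum_ite_mem, Finset.inter_eq_right.mpr hS] using this
  have h2 : ∑ g ∈ G \ S, ‖gproj e g z‖ - ∑ g ∈ S, ‖gproj e g z‖ ≤
      groupNormR e G (x + z) - groupNormR e G x := by
    rw [groupNormR, groupNormR, ← Finset.sum_sub_distrib, ← Finset.sum_sdiff hS, sub_eq_add_neg,
      ← Finset.sum_neg_distrib]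
    refine add_le_add (Finset.sum_le_sum fun g hg => ?_) (Finset.sum_le_sum fun g _ => ?_)
    · have hg' := Finset.mem_sdiff.mp hg
      have h0 : gproj e g x = 0 := by
        rw [hxS]
        exact gproj_gprojS_of_notMem he hG hS hg'.1 hg'.2 x
      simp [gproj_add, h0]
    · rw [gproj_add]
      have := norm_sub_le (gproj e g x + gproj e g z) (gproj e g z)
      rw [add_sub_cancel_right] at this
      linarith
  have h3 := Finset.sum_sdiff hS (f := fun g => ‖gproj e g z‖)
  have h4 := Finset.sum_sdiff hT (f := fun g => ‖gproj e g z‖)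
  linarith

/-- A block error splits into a `K`-group-sparse head and a tail lying in a polytope. -/
theorem exists_head_tail {e : ℕ → H} (he : Orthonormal ℝ e)
    {G : Finset (Finset ℕ)} (hG : (G : Set (Finset ℕ)).Pairwise fun g g' => Disjoint g g')
    {K : ℕ} (hK1 : 1 ≤ K) (hKG : K ≤ G.card) {x z : H} (hx : x ∈ SigmaK e G K)
    (hz : z ∈ Egrp e G) :
    ∃ T ⊆ G, T.card ≤ K ∧ (gprojS e T z = 0 → z = 0) ∧ ∃ l r : ℝ, 0 ≤ l ∧ 0 ≤ r ∧
      r ^ 2 ≤ ‖gprojS e T z‖ ^ 2 + l ^ 2 / K ∧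
      l ≤ √K * ‖gprojS e T z‖ + (groupNormR e G (x + z) - groupNormR e G x) ∧
      ∀ y, ∃ S ⊆ G, S.card ≤ K ∧ ⟪y, z - gprojS e T z⟫ ≤ r * ‖gprojS e S y‖ := by
  obtain ⟨T, hT, hcard, β, ⟨g₀, hg₀, hβ⟩, hβT, hβc⟩ :=
    exists_subset_card_eq_threshold G (fun g => ‖gproj e g z‖) hK1 hKG
  have hβ0 : 0 ≤ β := hβ ▸ norm_nonneg _
  have hK0 : (0 : ℝ) < K := by exact_mod_cast hK1
  have hzG := gprojS_eq_self_of_mem_Egrp he hG hz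
  have hu : z - gprojS e T z = gprojS e (G \ T) z := by
    conv_lhs => rw [← hzG]
    rw [hzG, sub_eq_iff_eq_add, gprojS, gprojS, Finset.sum_sdiff hT]
    exact hzG.symm
  have hβle : K * β ^ 2 ≤ ‖gprojS e T z‖ ^ 2 := by
    rw [norm_gprojS_sq he hG hT, ← hcard, ← nsmul_eq_mul]
    exact Finset.card_nsmul_le_sum _ _ _ fun g hg => pow_le_pow_left₀ hβ0 (hβT g hg) 2
  set l := ∑ g ∈ G \ T, ‖gproj e g z‖ with hl
  have hl0 : 0 ≤ l := Finset.sum_nonneg fun _ _ => norm_nonneg _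
  refine ⟨T, hT, hcard.le, fun h0 => ?_, l, max β (l / K) * √K, hl0, by positivity, ?_, ?_, ?_⟩
  · have hb : β = 0 := by
      rw [h0, norm_zero] at hβle
      by_contra hne
      have : 0 < K * β ^ 2 := by positivity
      linarith
    have : gprojS e (G \ T) z = 0 := Finset.sum_eq_zero fun g hg =>
      norm_le_zero_iff.mp ((hβc g hg).trans hb.le)
    rwa [h0, sub_zero, this] at hu
  · rw [mul_pow, Real.sq_sqrt hK0.le]
    rcases max_cases β (l / K) with ⟨h, -⟩ | ⟨h, -⟩ <;> rw [h]
    · have : 0 ≤ l ^ 2 / K := by positivity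
      linarith
    · have : (l / K) ^ 2 * K = l ^ 2 / K := by field_simp
      rw [this]
      linarith [sq_nonneg ‖gprojS e T z‖]
  · have h1 := le_groupNormR_add_sub he hG hT (hcard.symm ▸ hx) z hβ0 hβT hβc
    have h2 := sum_norm_gproj_le he hG hT z
    rw [hcard] at h2
    linarith
  · rw [hu]
    have hsd : G \ T ⊆ G := Finset.sdiff_subset
    have hin : ∀ g ∈ G \ T, gproj e g (gprojS e (G \ T) z) = gproj e g z := fun g hg =>
      gproj_gprojS_of_mem he hG hsd hg z
    have hout : ∀ g ∈ T, gproj e g (gprojS e (G \ T) z) = 0 := fun g hg =>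
      gproj_gprojS_of_notMem he hG hsd (hT hg) (fun h => (Finset.mem_sdiff.mp h).2 hg) z
    refine exists_inner_le_mul_norm_gprojS he hG hK1 hKG
      (gprojS_eq_self_of_mem_Egrp he hG (gprojS_mem_Egrp e hsd z)) (fun g hg => ?_) ?_
    · by_cases hgT : g ∈ T
      · rw [hout g hgT, norm_zero]
        exact le_max_of_le_left hβ0
      · have hg' := Finset.mem_sdiff.mpr ⟨hg, hgT⟩
        rw [hin g hg']
        exact le_max_of_le_left (hβc g hg')
    · rw [groupNormR, ← Finset.sum_sdiff hT,
        Finset.sum_congr rfl fun g hg => by rw [hin g hg],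
        Finset.sum_eq_zero (s := T) fun g hg => by rw [hout g hg, norm_zero], add_zero, ← hl]
      calc l = K * (l / K) := by field_simp
        _ ≤ _ := by gcongr; exact le_max_right _ _

/-- A vector dominated by the support function of the unit sphere of a cone has bounded
atomic norm. -/
theorem coneNorm_le_of_forall_inner_le [CompleteSpace H] {S : Set H}
    (hS : ∀ (c : ℝ), ∀ x ∈ S, c • x ∈ S) (hne : ∃ x ∈ S, x ≠ 0) {u : H} {r : ℝ} (hr : 0 < r)
    (h : ∀ y, ∃ x ∈ S, ⟪y, u⟫ ≤ r * ‖x‖ ∧ ⟪y, x⟫ = ‖x‖ ^ 2) :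
    coneNorm S u ≤ ENNReal.ofReal r := by
  suffices hu : r⁻¹ • u ∈ closure (convexHull ℝ (S ∩ sphere (0 : H) 1)) from
    iInf_le (fun t : {t : ℝ // 0 ≤ t ∧ u ∈ t • closure (convexHull ℝ (S ∩ sphere (0 : H) 1))} =>
      ENNReal.ofReal (t : ℝ)) ⟨r, hr.le, r⁻¹ • u, hu, smul_inv_smul₀ hr.ne' u⟩
  by_contra hu
  obtain ⟨f, s, hfs, hsu⟩ := geometric_hahn_banach_closed_point
    (convex_convexHull ℝ _).closure isClosed_closure hu
  have hmem : ∀ x ∈ S, ∀ c : ℝ, ‖c • x‖ = 1 → f (c • x) < s := fun x hx c hc =>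
    hfs _ (subset_closure (subset_convexHull ℝ _ ⟨hS c x hx, by simpa using hc⟩))
  have hs : 0 < s := by
    obtain ⟨x, hx, hx0⟩ := hne
    have hx' : ‖x‖ ≠ 0 := norm_ne_zero_iff.mpr hx0
    have h1 := hmem x hx ‖x‖⁻¹ (by simp [norm_smul, hx'])
    have h2 := hmem x hx (-‖x‖⁻¹) (by simp [norm_smul, hx'])
    rw [neg_smul, map_neg] at h2
    linarith
  obtain ⟨x, hx, hux, hyx⟩ := h ((InnerProductSpace.toDual ℝ H).symm f)
  rw [InnerProductSpace.toDual_symm_apply] at hux hyx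
  rw [map_smul, smul_eq_mul] at hsu
  have hle : r⁻¹ * f u ≤ ‖x‖ := by
    rw [inv_mul_le_iff₀ hr]
    exact hux
  by_cases hx0 : ‖x‖ = 0
  · linarith
  · have := hmem x hx ‖x‖⁻¹ (by simp [norm_smul, hx0])
    rw [map_smul, hyx, smul_eq_mul, pow_two, inv_mul_cancel_left₀ hx0] at this
    linarith

theorem le_deltaUoS_neg {S : Set H} {x u : H} (hx : x ≠ 0) (hxu : ⟪x, u⟫ = 0) {c : ℝ}
    (hc : 0 ≤ c) (h : coneNorm S u ≤ ENNReal.ofReal (√(1 + c) * ‖x‖)) :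
    1 / √(2 + c) ≤ deltaUoS S (-x) (x + u) := by
  have hx0 : 0 < ‖x‖ := norm_pos_iff.mpr hx
  have hn : -x + (x + u) = u := by abel
  rw [deltaUoS, hn, if_neg (ne_top_of_le_ne_top ENNReal.ofReal_ne_top h), inner_neg_left,
    inner_add_right, hxu, real_inner_self_eq_norm_sq, norm_neg]
  have hle : (coneNorm S u).toReal ≤ √(1 + c) * ‖x‖ :=
    ENNReal.toReal_le_of_le_ofReal (by positivity) h
  have hsq : (coneNorm S u).toReal ^ 2 ≤ (1 + c) * ‖x‖ ^ 2 := by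
    calc _ ≤ (√(1 + c) * ‖x‖) ^ 2 := pow_le_pow_left₀ ENNReal.toReal_nonneg hle 2
      _ = _ := by rw [mul_pow, Real.sq_sqrt (by positivity)]
  set a := (coneNorm S u).toReal
  have harg : a ^ 2 - ‖x‖ ^ 2 - 2 * -(‖x‖ ^ 2 + 0) = a ^ 2 + ‖x‖ ^ 2 := by ring
  rw [harg]
  have hpos : 0 < √(a ^ 2 + ‖x‖ ^ 2) := by positivity
  have hs : √(a ^ 2 + ‖x‖ ^ 2) ≤ √(2 + c) * ‖x‖ := by
    rw [← Real.sqrt_sq hx0.le, ← Real.sqrt_mul (by positivity)]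
    apply Real.sqrt_le_sqrt
    rw [Real.sqrt_sq hx0.le]
    linarith
  rw [div_le_div_iff₀ (by positivity) (by positivity)]
  nlinarith

theorem sum_sq_le_of_weighted_sum_le {J : ℕ} {K w l r t : Fin J → ℝ} {m M : ℝ} (hm : 0 < m)
    (hK : ∀ j, 0 < K j) (hw : ∀ j, 0 < w j) (hmw : ∀ j, m ≤ w j * √(K j))
    (hMw : ∀ j, w j * √(K j) ≤ M) (hl : ∀ j, 0 ≤ l j) (ht : ∀ j, 0 ≤ t j)
    (hr : ∀ j, r j ^ 2 ≤ t j ^ 2 + l j ^ 2 / K j)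
    (hsum : ∑ j, w j * l j ≤ ∑ j, w j * √(K j) * t j) :
    ∑ j, r j ^ 2 ≤ (1 + J * (M / m) ^ 2) * ∑ j, t j ^ 2 := by
  have h1 : ∀ j, l j ^ 2 / K j ≤ (w j * l j) ^ 2 / m ^ 2 := fun j => by
    have h : m ^ 2 ≤ w j ^ 2 * K j := by
      calc m ^ 2 ≤ (w j * √(K j)) ^ 2 := pow_le_pow_left₀ hm.le (hmw j) 2
        _ = _ := by rw [mul_pow, Real.sq_sqrt (hK j).le]
    rw [div_le_div_iff₀ (hK j) (by positivity)]
    nlinarith [mul_le_mul_of_nonneg_left h (sq_nonneg (l j))]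
  have h2 : ∑ j, (w j * l j) ^ 2 ≤ (∑ j, w j * l j) ^ 2 :=
    Finset.sum_sq_le_sq_sum_of_nonneg fun j _ => mul_nonneg (hw j).le (hl j)
  have h3 : ∑ j, w j * l j ≤ M * ∑ j, t j := by
    rw [Finset.mul_sum]
    exact hsum.trans (Finset.sum_le_sum fun j _ => mul_le_mul_of_nonneg_right (hMw j) (ht j))
  have h4 : (∑ j, t j) ^ 2 ≤ J * ∑ j, t j ^ 2 := by
    simpa using sq_sum_le_card_mul_sum_sq (s := Finset.univ) (f := t)
  have h5 : (∑ j, w j * l j) ^ 2 ≤ M ^ 2 * (J * ∑ j, t j ^ 2) := by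
    calc _ ≤ (M * ∑ j, t j) ^ 2 :=
          pow_le_pow_left₀ (Finset.sum_nonneg fun j _ => mul_nonneg (hw j).le (hl j)) h3 2
      _ ≤ _ := by rw [mul_pow]; gcongr
  calc ∑ j, r j ^ 2 ≤ ∑ j, (t j ^ 2 + (w j * l j) ^ 2 / m ^ 2) :=
        Finset.sum_le_sum fun j _ => (hr j).trans (add_le_add_right (h1 j) _)
    _ = ∑ j, t j ^ 2 + (∑ j, (w j * l j) ^ 2) / m ^ 2 := by
        rw [Finset.sum_add_distrib, Finset.sum_div]
    _ ≤ ∑ j, t j ^ 2 + M ^ 2 * (J * ∑ j, t j ^ 2) / m ^ 2 := by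
        gcongr
        exact h2.trans h5
    _ = _ := by field_simp

theorem SigmaK_subset_Egrp (e : ℕ → H) (G : Finset (Finset ℕ)) (K : ℕ) :
    SigmaK e G K ⊆ Egrp e G := by
  rintro x ⟨S, hS, -, hx⟩
  rw [hx]
  exact gprojS_mem_Egrp e hS x

theorem groupNormR_nonneg (e : ℕ → H) (G : Finset (Finset ℕ)) (x : H) : 0 ≤ groupNormR e G x :=
  Finset.sum_nonneg fun _ _ => norm_nonneg _

theorem blockNorm_eq_ofReal (e : ∀ j, ℕ → Hs j) (G : Fin J → Finset (Finset ℕ))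
    {w : Fin J → ℝ} (hw : ∀ j, 0 < w j) {x : PiLp 2 Hs} (hx : ∀ j, x j ∈ Egrp (e j) (G j)) :
    blockNorm e G w x = ENNReal.ofReal (∑ j, w j * groupNormR (e j) (G j) (x j)) := by
  rw [blockNorm, ENNReal.ofReal_sum_of_nonneg fun j _ =>
    mul_nonneg (hw j).le (groupNormR_nonneg _ _ _)]
  refine Finset.sum_congr rfl fun j _ => ?_
  rw [groupNorm, if_pos (hx j), ENNReal.ofReal_mul (hw j).le]

theorem mem_Egrp_of_blockNorm_ne_top (e : ∀ j, ℕ → Hs j) (G : Fin J → Finset (Finset ℕ))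
    {w : Fin J → ℝ} (hw : ∀ j, 0 < w j) {x : PiLp 2 Hs} (hx : blockNorm e G w x ≠ ⊤) (j : Fin J) :
    x j ∈ Egrp (e j) (G j) := by
  by_contra h
  have h1 := (ENNReal.sum_ne_top.mp hx) j (Finset.mem_univ j)
  rw [groupNorm, if_neg h, ENNReal.mul_top (by simpa using hw j)] at h1
  exact h1 rfl

theorem weighted_descent_of_blockNorm_le (e : ∀ j, ℕ → Hs j) (G : Fin J → Finset (Finset ℕ))
    {w : Fin J → ℝ} (hw : ∀ j, 0 < w j) {x z : PiLp 2 Hs} (hx : ∀ j, x j ∈ Egrp (e j) (G j))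
    (h : blockNorm e G w (x + z) ≤ blockNorm e G w x) :
    (∀ j, z j ∈ Egrp (e j) (G j)) ∧
      ∑ j, w j * (groupNormR (e j) (G j) (x j + z j) - groupNormR (e j) (G j) (x j)) ≤ 0 := by
  rw [blockNorm_eq_ofReal e G hw hx] at h
  have hxz := mem_Egrp_of_blockNorm_ne_top e G hw (ne_top_of_le_ne_top ENNReal.ofReal_ne_top h)
  refine ⟨fun j => ?_, ?_⟩
  · have := Submodule.sub_mem _ (hxz j) (hx j)
    rwa [PiLp.add_apply, add_sub_cancel_left] at this
  · rw [blockNorm_eq_ofReal e G hw hxz, ENNReal.ofReal_le_ofReal_iff (Finset.sum_nonneg fun j _ =>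
      mul_nonneg (hw j).le (groupNormR_nonneg _ _ _))] at h
    simp only [mul_sub, Finset.sum_sub_distrib]
    simp only [PiLp.add_apply] at h
    linarith

theorem inv_sqrt_le_deltaAdmUoS_blockModel [∀ j, CompleteSpace (Hs j)]
    {e : ∀ j, ℕ → Hs j} (he : ∀ j, Orthonormal ℝ (e j)) {G : Fin J → Finset (Finset ℕ)}
    (hG : ∀ j, (G j : Set (Finset ℕ)).Pairwise fun g g' => Disjoint g g')
    {K : Fin J → ℕ} (hK1 : ∀ j, 1 ≤ K j) (hKG : ∀ j, K j ≤ (G j).card)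
    {w : Fin J → ℝ} (hw : ∀ j, 0 < w j) {m M : ℝ} (hm : 0 < m)
    (hmw : ∀ j, m ≤ w j * √(K j)) (hMw : ∀ j, w j * √(K j) ≤ M) :
    ((1 / √(2 + J * (M / m) ^ 2) : ℝ) : EReal) ≤
      deltaAdmUoS (blockModel e G K)
        {z : PiLp 2 Hs | ∃ x ∈ blockModel e G K,
          blockNorm e G w (x + z) ≤ blockNorm e G w x} := by
  refine le_iInf fun ⟨z, ⟨x, hx, hxz⟩, hz0⟩ => ?_
  obtain ⟨hz, hdesc⟩ := weighted_descent_of_blockNorm_le e G hw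
    (fun j => SigmaK_subset_Egrp _ _ _ (hx j)) hxz
  choose T hT hTK hT0 l r hl hr hrt hlt hS using fun j =>
    exists_head_tail (he j) (hG j) (hK1 j) (hKG j) (hx j) (hz j)
  set v : PiLp 2 Hs := WithLp.toLp 2 fun j => gprojS (e j) (T j) (z j) with hv
  have hvj : ∀ j, v j = gprojS (e j) (T j) (z j) := fun _ => rfl
  have hsmul : ∀ (c : ℝ), ∀ y ∈ blockModel e G K, c • y ∈ blockModel e G K :=
    fun c y hy j => SigmaK_smul_mem (hy j) c
  have hvmem : v ∈ blockModel e G K := fun j => gprojS_mem_SigmaK (he j) (hG j) (hT j) (hTK j) _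
  have hv0 : v ≠ 0 := fun h => hz0 <| PiLp.ext fun j => hT0 j <| by
    rw [← hvj, h, PiLp.zero_apply]
  have hvu : ⟪v, z - v⟫ = 0 := by
    rw [PiLp.inner_apply]
    refine Finset.sum_eq_zero fun j _ => ?_
    rw [PiLp.sub_apply, inner_sub_right, hvj, inner_gprojS_self (he j) (hG j) (hT j),
      real_inner_self_eq_norm_sq, sub_self]
  have hrsum := sum_sq_le_of_weighted_sum_le (K := fun j => (K j : ℝ)) (r := r)
    (t := fun j => ‖v j‖) hm (fun j => by exact_mod_cast hK1 j) hw hmw hMw hl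
    (fun _ => norm_nonneg _) hrt <| by
      have h1 : ∑ j, w j * l j ≤ ∑ j, (w j * √(K j) * ‖v j‖ +
          w j * (groupNormR (e j) (G j) (x j + z j) - groupNormR (e j) (G j) (x j))) :=
        Finset.sum_le_sum fun j _ => by
          have := mul_le_mul_of_nonneg_left (hlt j) (hw j).le
          rwa [mul_add, ← mul_assoc] at this
      rw [Finset.sum_add_distrib] at h1
      linarith
  rw [← PiLp.norm_sq_eq_of_L2] at hrsum
  have hcone : coneNorm (blockModel e G K) (z - v) ≤
      ENNReal.ofReal (√(1 + J * (M / m) ^ 2) * ‖v‖) := by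
    have hvpos := norm_pos_iff.mpr hv0
    refine coneNorm_le_of_forall_inner_le hsmul ⟨v, hvmem, hv0⟩ (by positivity) fun y => ?_
    choose S hSG hSK hyS using fun j => hS j (y j)
    refine ⟨WithLp.toLp 2 fun j => gprojS (e j) (S j) (y j),
      fun j => gprojS_mem_SigmaK (he j) (hG j) (hSG j) (hSK j) _, ?_, ?_⟩
    · rw [PiLp.inner_apply, PiLp.norm_eq_of_L2 (WithLp.toLp 2 fun j => gprojS (e j) (S j) (y j))]
      refine (Finset.sum_le_sum fun j _ => hyS j).trans
        ((Real.sum_mul_le_sqrt_mul_sqrt _ _ _).trans ?_)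
      refine mul_le_mul_of_nonneg_right ?_ (Real.sqrt_nonneg _)
      refine (Real.sqrt_le_sqrt hrsum).trans_eq ?_
      rw [Real.sqrt_mul (by positivity), Real.sqrt_sq (norm_nonneg _)]
    · rw [PiLp.inner_apply, PiLp.norm_sq_eq_of_L2]
      refine Finset.sum_congr rfl fun j _ => ?_
      rw [real_inner_comm]
      exact inner_gprojS_self (he j) (hG j) (hSG j) (y j)
  refine le_iSup_of_le ⟨-v, ?_, neg_ne_zero.mpr hv0⟩ (EReal.coe_le_coe_iff.mpr ?_)
  · simpa using hsmul (-1) v hvmem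
  · simpa using le_deltaUoS_neg hv0 hvu (by positivity) hcone

theorem stmt15 [∀ j, CompleteSpace (Hs j)] (hJ : 1 ≤ J)
    (e : ∀ j, ℕ → Hs j) (he : ∀ j, Orthonormal ℝ (e j))
    (htot : ∀ j, (Submodule.span ℝ (Set.range (e j))).topologicalClosure = ⊤)
    (G : Fin J → Finset (Finset ℕ)) (hGne : ∀ j, ∀ g ∈ G j, g.Nonempty)
    (hGdisj : ∀ j, (G j : Set (Finset ℕ)).Pairwise fun g g' => Disjoint g g')
    (K : Fin J → ℕ) (hK1 : ∀ j, 1 ≤ K j) (hKG : ∀ j, K j ≤ (G j).card)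
    (w : Fin J → ℝ) (hw : ∀ j, 0 < w j) :
    (((1 / Real.sqrt (2 + (J : ℝ) *
        ((⨆ j, w j * Real.sqrt (K j)) / (⨅ j, w j * Real.sqrt (K j))) ^ 2) : ℝ)) : EReal) ≤
      deltaAdmUoS (blockModel e G K)
        {z : PiLp 2 Hs | ∃ x ∈ blockModel e G K,
          blockNorm e G w (x + z) ≤ blockNorm e G w x} ∧
    ((∀ j, w j = 1 / Real.sqrt (K j)) →
      (((1 / Real.sqrt (2 + (J : ℝ)) : ℝ)) : EReal) ≤
        deltaAdmUoS (blockModel e G K)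
          {z : PiLp 2 Hs | ∃ x ∈ blockModel e G K,
            blockNorm e G w (x + z) ≤ blockNorm e G w x}) := by
  have : Nonempty (Fin J) := ⟨⟨0, hJ⟩⟩
  have hpos : ∀ j, 0 < w j * √(K j) := fun j =>
    mul_pos (hw j) (Real.sqrt_pos.mpr (by exact_mod_cast hK1 j))
  refine ⟨?_, fun hwK => ?_⟩
  · obtain ⟨j₀, hj₀⟩ := exists_eq_ciInf_of_finite (f := fun j => w j * √(K j))
    exact inv_sqrt_le_deltaAdmUoS_blockModel he hGdisj hK1 hKG hw (hj₀ ▸ hpos j₀)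
      (fun j => ciInf_le (Set.finite_range _).bddBelow j)
      (fun j => le_ciSup (f := fun j => w j * √(K j)) (Set.finite_range _).bddAbove j)
  · have h1 : ∀ j, w j * √(K j) = 1 := fun j => by
      have := hpos j
      rw [hwK j] at this ⊢
      exact one_div_mul_cancel fun h => by simp [h] at this
    simpa using inv_sqrt_le_deltaAdmUoS_blockModel he hGdisj hK1 hKG hw one_pos
      (fun j => (h1 j).ge) (fun j => (h1 j).le)
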